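/- Let Γ ≤ Diff^ω₊(I) be a non-Abelian subgroup possessing a nontrivial Abelian normal subgroup. Then Γ is not C₀-discrete; moreover, every nontrivial Abelian normal subgroup of Γ is not C₀-discrete. -/

import Mathlib

open Set

namespace HeightHomeo

/-- The group of orientation-preserving homeomorphisms of a linearly ordered space,
modeled as order-automorphisms (for `I = [0,1]` these are exactly the
orientation-preserving homeomorphisms). -/
instance ordIsoGroup {α : Type*} [Preorder α] : Group (α ≃o α) where
  mul f g := g.trans f
  one := OrderIso.refl α
  inv := OrderIso.symm
  mul_assoc _ _ _ := rfl
  one_mul _ := rfl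
  mul_one _ := rfl
  inv_mul_cancel f := by ext x; exact f.symm_apply_apply x

/-- `Homeo₊(I)`: the group of orientation-preserving homeomorphisms of the closed
unit interval `I = [0,1]`. -/
abbrev HomeoI := unitInterval ≃o unitInterval

/-- The order-convex hull of a set of points of the unit interval. -/
def ordHull (S : Set unitInterval) : Set unitInterval :=
  {y | ∃ a ∈ S, ∃ b ∈ S, a ≤ y ∧ y ≤ b}

/-- `A` is an orbital of the homeomorphism `g`: the convex hull of the orbit of some
point of `I` under the cyclic subgroup `⟨g⟩`, provided it contains more than one point. -/
def IsOrbitalOf (g : HomeoI) (A : Set unitInterval) : Prop :=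
  ∃ x : unitInterval,
    A = ordHull (Set.range fun n : ℤ => (g ^ n) x) ∧ A.Nontrivial

/-- A tower of a subgroup `Γ ≤ Homeo₊(I)`: a set `T` of signed orbitals `(A, g)`
(with `g ∈ Γ` and `A` an orbital of `g`) whose orbitals form a chain under inclusion,
and containing exactly one signed orbital for each of the occurring orbitals. -/
def IsTower (Γ : Subgroup HomeoI) (T : Set (Set unitInterval × HomeoI)) : Prop :=
  (∀ p ∈ T, p.2 ∈ Γ ∧ IsOrbitalOf p.2 p.1) ∧
  (∀ p ∈ T, ∀ q ∈ T, p.1 ⊆ q.1 ∨ q.1 ⊆ p.1) ∧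
  (∀ p ∈ T, ∀ q ∈ T, p.1 = q.1 → p = q)

/-- The left endpoint of a set of points of the unit interval, as a real number. -/
noncomputable def leftEnd (A : Set unitInterval) : ℝ :=
  sInf ((fun x : unitInterval => (x : ℝ)) '' A)

/-- The right endpoint of a set of points of the unit interval, as a real number. -/
noncomputable def rightEnd (A : Set unitInterval) : ℝ :=
  sSup ((fun x : unitInterval => (x : ℝ)) '' A)

/-- Two intervals share an end if they have a common left endpoint or a common right
endpoint. -/
def ShareEnd (A B : Set unitInterval) : Prop :=
  leftEnd A = leftEnd B ∨ rightEnd A = rightEnd B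

/-- A tower is strict if no two distinct orbitals occurring in it share an end. -/
def IsStrictTower (Γ : Subgroup HomeoI) (T : Set (Set unitInterval × HomeoI)) : Prop :=
  IsTower Γ T ∧ ∀ p ∈ T, ∀ q ∈ T, p.1 ≠ q.1 → ¬ ShareEnd p.1 q.1

/-- The set of orbitals occurring in a tower. -/
def towerOrbitals (T : Set (Set unitInterval × HomeoI)) : Set (Set unitInterval) :=
  Prod.fst '' T

/-- The height `h(Γ)` of a subgroup of `Homeo₊(I)`: the supremum (in `ℕ∞`) of the
cardinalities of the sets of orbitals of its towers. -/
noncomputable def height (Γ : Subgroup HomeoI) : ℕ∞ :=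
  ⨆ T ∈ {T | IsTower Γ T}, (towerOrbitals T).encard

/-- The strict height `h_strict(Γ)` of a subgroup of `Homeo₊(I)`: the supremum (in
`ℕ∞`) of the cardinalities of the sets of orbitals of its strict towers. -/
noncomputable def strictHeight (Γ : Subgroup HomeoI) : ℕ∞ :=
  ⨆ T ∈ {T | IsStrictTower Γ T}, (towerOrbitals T).encard

/-- `f ∈ Diff^ω₊(I)`: `f` extends to a real-analytic map on a neighborhood of `[0,1]`
(being an order-automorphism of `[0,1]`, `f` is automatically strictly increasing and
fixes `0` and `1`). -/
def IsAnalytic (f : HomeoI) : Prop :=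
  ∃ F : ℝ → ℝ, (∀ x ∈ Set.Icc (0 : ℝ) 1, AnalyticAt ℝ F x) ∧
    ∀ x : unitInterval, F x = (f x : ℝ)

/-- A subgroup `Γ ≤ Homeo₊(I)` is `C⁰`-discrete if the identity is isolated in `Γ`
with respect to the metric `d(f,g) = sup_{x ∈ [0,1]} |f x - g x|`. -/
def C0Discrete (Γ : Subgroup HomeoI) : Prop :=
  ∃ ε > (0 : ℝ), ∀ f ∈ Γ, f ≠ 1 → ∃ x : unitInterval, ε ≤ |(f x : ℝ) - (x : ℝ)|

open Filter Topology

/-- A form of Hölder's theorem: Archimedean bi-ordered groups are commutative. -/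
lemma mul_comm_of_archimedean {G : Type*} [Group G] [LinearOrder G] [MulLeftMono G]
    [MulRightMono G] (harch : ∀ a b : G, 1 < a → ∃ n : ℕ, b < a ^ n) (a b : G) :
    a * b = b * a := by
  have key : ∀ d g : G, 1 < d → ∃ k : ℤ, d ^ k ≤ g ∧ g < d ^ (k + 1) := by
    intro d g hd
    have hmono : StrictMono fun k : ℤ => d ^ k := by
      refine strictMono_int_of_lt_succ fun k => ?_
      rw [zpow_add_one]
      exact lt_mul_of_one_lt_right' _ hd
    obtain ⟨n, hn⟩ := harch d g hd
    obtain ⟨m, hm⟩ := harch d g⁻¹ hd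
    obtain ⟨k, hk, hk'⟩ := Int.exists_greatest_of_bdd (P := fun k : ℤ => d ^ k ≤ g)
      ⟨n, fun z hz => (hmono.lt_iff_lt.1 (hz.trans_lt (by simpa using hn))).le⟩
      ⟨-m, by simpa using (inv_lt'.1 hm).le⟩
    refine ⟨k, hk, lt_of_not_ge fun h => ?_⟩
    have := hk' _ h
    omega
  by_cases hmin : ∃ d : G, 1 < d ∧ ∀ e : G, 1 < e → d ≤ e
  · obtain ⟨d, hd, hle⟩ := hmin
    have hpow : ∀ g : G, ∃ k : ℤ, g = d ^ k := by
      intro g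
      obtain ⟨k, h1, h2⟩ := key d g hd
      refine ⟨k, ?_⟩
      by_contra hne
      have hlt : d ^ k < g := lt_of_le_of_ne h1 (Ne.symm hne)
      have h3 := hle ((d ^ k)⁻¹ * g) (by rwa [lt_inv_mul_iff_mul_lt, mul_one])
      rw [le_inv_mul_iff_mul_le, ← zpow_add_one] at h3
      exact absurd h2 (not_lt.2 h3)
    obtain ⟨k, rfl⟩ := hpow a
    obtain ⟨l, rfl⟩ := hpow b
    exact (Commute.refl d).zpow_zpow k l
  · push Not at hmin
    have hhalf : ∀ e : G, 1 < e → ∃ d : G, 1 < d ∧ d * d ≤ e := by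
      intro e he
      obtain ⟨d, hd, hde⟩ := hmin e he
      rcases le_or_gt (d * d) e with h | h
      · exact ⟨d, hd, h⟩
      · refine ⟨e * d⁻¹, by rwa [lt_mul_inv_iff_mul_lt, one_mul], ?_⟩
        have h1 : d⁻¹ * e * d⁻¹ ≤ 1 := by
          rw [mul_inv_le_iff_le_mul, one_mul, inv_mul_le_iff_le_mul]
          exact h.le
        calc e * d⁻¹ * (e * d⁻¹) = e * (d⁻¹ * e * d⁻¹) := by group
          _ ≤ e * 1 := mul_le_mul_right h1 e
          _ = e := mul_one e
    have hle : ∀ a b : G, a * b ≤ b * a := by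
      intro a b
      by_contra! hlt
      have he : 1 < a * b * (b * a)⁻¹ := by rwa [lt_mul_inv_iff_mul_lt, one_mul]
      obtain ⟨d, hd, hdd⟩ := hhalf _ he
      obtain ⟨k, hk1, hk2⟩ := key d a hd
      obtain ⟨l, hl1, hl2⟩ := key d b hd
      have h1 : a * b < d ^ (k + 1) * d ^ (l + 1) := mul_lt_mul_of_lt_of_lt hk2 hl2
      have h2 : d ^ l * d ^ k ≤ b * a := mul_le_mul' hl1 hk1
      have h3 : d * d * (b * a) ≤ a * b := by
        rwa [le_mul_inv_iff_mul_le] at hdd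
      have h4 : d * d * (d ^ l * d ^ k) ≤ d * d * (b * a) := mul_le_mul_right h2 _
      have h5 : d * d * (d ^ l * d ^ k) = d ^ (k + 1) * d ^ (l + 1) := by
        simp only [← zpow_add, ← zpow_one_add, mul_assoc]
        congr 1
        ring
      exact absurd (h1.trans_le (h5 ▸ h4.trans h3)) (lt_irrefl _)
    exact le_antisymm (hle a b) (hle b a)

lemma mul_apply (f g : HomeoI) (x : unitInterval) : (f * g) x = f (g x) := rfl

lemma one_apply (x : unitInterval) : (1 : HomeoI) x = x := rfl

lemma inv_apply_self (f : HomeoI) (x : unitInterval) : f⁻¹ (f x) = x := f.symm_apply_apply x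

lemma apply_inv_self (f : HomeoI) (x : unitInterval) : f (f⁻¹ x) = x := f.apply_symm_apply x

lemma ext_homeoI {f g : HomeoI} (h : ∀ x, f x = g x) : f = g := DFunLike.ext _ _ h

lemma inv_apply_eq_self {f : HomeoI} {x : unitInterval} : f⁻¹ x = x ↔ f x = x :=
  ⟨fun h => by conv_lhs => rw [← h, apply_inv_self],
    fun h => by conv_lhs => rw [← h, inv_apply_self]⟩

/-- The orbit of a point moved up by `f` increases to a fixed point of `f`. -/
lemma exists_fixed_limit {f : HomeoI} {x : unitInterval} (h : x < f x) :
    ∃ s, f s = s ∧ (∀ n : ℕ, (f ^ n) x < s) ∧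
      Tendsto (fun n : ℕ => (f ^ n) x) atTop (𝓝 s) := by
  have hmono : StrictMono fun n : ℕ => (f ^ n) x := by
    refine strictMono_nat_of_lt_succ fun n => ?_
    rw [pow_succ, mul_apply]
    exact (f ^ n).strictMono h
  have hlim := tendsto_atTop_ciSup hmono.monotone (OrderTop.bddAbove _)
  refine ⟨_, ?_, fun n => ?_, hlim⟩
  · have h1 := (f.continuous.tendsto _).comp hlim
    have h2 := hlim.comp (tendsto_add_atTop_nat 1)
    refine tendsto_nhds_unique h1 (h2.congr fun n => ?_)
    simp only [Function.comp, pow_succ', mul_apply]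
  · exact (hmono (Nat.lt_succ_self n)).trans_le
      (le_ciSup (f := fun n : ℕ => (f ^ n) x) (OrderTop.bddAbove _) (n + 1))

/-- Points moved up by `f` pass beyond any homeomorphism fixing the fixed points of `f`. -/
lemma exists_lt_pow_apply {f g : HomeoI} (hfg : ∀ x, f x = x → g x = x) {x : unitInterval}
    (h : x < f x) : ∃ n : ℕ, g x < (f ^ n) x := by
  by_contra! hle
  obtain ⟨s, hs, hlt, hlim⟩ := exists_fixed_limit h
  have h1 : s ≤ g x := le_of_tendsto' hlim hle
  rw [← hfg s hs, g.le_iff_le] at h1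
  exact absurd (hlt 0) (not_lt.2 h1)

/-- A nontrivial analytic homeomorphism has isolated fixed points. -/
lemma eq_one_of_frequently {f : HomeoI} (hf : IsAnalytic f) {a : unitInterval}
    (h : ∃ᶠ x in 𝓝[≠] a, f x = x) : f = 1 := by
  obtain ⟨F, hF, hFf⟩ := hf
  have hfr : ∃ᶠ x in 𝓝[≠] (a : ℝ), F x = id x := by
    have ht : Tendsto (Subtype.val : unitInterval → ℝ) (𝓝[≠] a) (𝓝[≠] (a : ℝ)) :=
      tendsto_nhdsWithin_of_tendsto_nhds_of_eventually_within _
        ((continuous_subtype_val.tendsto a).mono_left nhdsWithin_le_nhds)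
        (eventually_nhdsWithin_of_forall fun x hx => fun hxa => hx (Subtype.ext hxa))
    refine ht.frequently (h.mono fun x hx => ?_)
    rw [hFf, hx]
    rfl
  have := AnalyticOnNhd.eqOn_of_preconnected_of_frequently_eq (U := Set.Icc (0 : ℝ) 1) hF
    analyticOnNhd_id isPreconnected_Icc a.2 hfr
  refine ext_homeoI fun x => Subtype.ext ?_
  rw [← hFf, this x.2]
  rfl

lemma eventually_apply_ne {f : HomeoI} (hf : IsAnalytic f) (h1 : f ≠ 1) (a : unitInterval) :
    ∀ᶠ x in 𝓝[≠] a, f x ≠ x := by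
  by_contra h
  exact h1 (eq_one_of_frequently hf ((not_eventually.1 h).mono fun x => not_not.1))

/-- A homeomorphism preserving the fixed point set of a nontrivial analytic `f` fixes it
pointwise. -/
lemma apply_eq_self_of_preserves {f g : HomeoI} (hf : IsAnalytic f) (h1 : f ≠ 1)
    (hg : ∀ x, f (g x) = g x ↔ f x = x) {x : unitInterval} (hx : f x = x) : g x = x := by
  have aux : ∀ g : HomeoI, (∀ x, f x = x → f (g x) = g x) → ¬ x < g x := by
    intro g hg hlt
    obtain ⟨s, -, hs, hlim⟩ := exists_fixed_limit hlt
    refine h1 (eq_one_of_frequently hf (a := s) ?_)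
    have hlim' : Tendsto (fun n : ℕ => (g ^ n) x) atTop (𝓝[≠] s) :=
      tendsto_nhdsWithin_of_tendsto_nhds_of_eventually_within _ hlim
        (Eventually.of_forall fun n => (hs n).ne)
    refine hlim'.frequently (Eventually.of_forall fun n => ?_).frequently
    induction n with
    | zero => exact hx
    | succ n ih => rw [pow_succ', mul_apply]; exact hg _ ih
  rcases lt_trichotomy (g x) x with h | h | h
  · refine absurd ?_ (aux g⁻¹ fun y hy => ?_)
    · rw [← g.lt_iff_lt, apply_inv_self]; exact h
    · rwa [← hg, apply_inv_self]
  · exact h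
  · exact absurd h (aux g fun y hy => (hg y).2 hy)

/-- Commuting nontrivial analytic homeomorphisms have the same fixed points. -/
lemma apply_eq_self_of_commute {f g : HomeoI} (hf : IsAnalytic f) (h1 : f ≠ 1)
    (hc : f * g = g * f) {x : unitInterval} (hx : f x = x) : g x = x := by
  refine apply_eq_self_of_preserves hf h1 (fun y => ?_) hx
  rw [← mul_apply, hc, mul_apply, g.injective.eq_iff]

/-- A group of homeomorphisms whose nontrivial elements all have the same fixed point set is
Abelian. -/
lemma mul_comm_of_same_fixed {Γ : Subgroup HomeoI} {m : HomeoI} (hm1 : m ≠ 1)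
    (hfix : ∀ f ∈ Γ, f ≠ 1 → ∀ x, f x = x ↔ m x = x) :
    ∀ a ∈ Γ, ∀ b ∈ Γ, a * b = b * a := by
  obtain ⟨x₀, hx₀⟩ : ∃ x, m x ≠ x := by
    by_contra! h
    exact hm1 (ext_homeoI h)
  have hfix' : ∀ f ∈ Γ, ∀ x, m x = x → f x = x := by
    intro f hf x hx
    by_cases h1 : f = 1
    · rw [h1, one_apply]
    · exact (hfix f hf h1 x).2 hx
  have hfree : ∀ f ∈ Γ, f x₀ = x₀ → f = 1 := fun f hf h => by
    by_contra h1
    exact hx₀ ((hfix f hf h1 x₀).1 h)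
  have hinj : Function.Injective fun f : Γ => (f : HomeoI) x₀ := by
    intro f g hfg
    have h := hfree _ (Γ.mul_mem (Γ.inv_mem g.2) f.2)
      (by rw [mul_apply]; exact (congrArg _ hfg).trans (inv_apply_self _ _))
    exact Subtype.ext (inv_mul_eq_one.1 h).symm
  let _ : LinearOrder Γ := LinearOrder.lift' (fun f : Γ => (f : HomeoI) x₀) hinj
  have hlt : ∀ f g : Γ, f < g ↔ (f : HomeoI) x₀ < (g : HomeoI) x₀ := fun f g => Iff.rfl
  have hle : ∀ f g : Γ, f ≤ g ↔ (f : HomeoI) x₀ ≤ (g : HomeoI) x₀ := fun f g => Iff.rfl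
  have _ : MulLeftMono Γ := ⟨fun k f g h => by
    have : (k : HomeoI) ((f : HomeoI) x₀) ≤ (k : HomeoI) ((g : HomeoI) x₀) :=
      (k : HomeoI).monotone h
    exact this⟩
  have _ : MulRightMono Γ := ⟨fun k f g h => by
    change (f : HomeoI) ((k : HomeoI) x₀) ≤ (g : HomeoI) ((k : HomeoI) x₀)
    by_contra! hcon
    obtain ⟨z, hz, hfz⟩ := isPreconnected_uIcc.intermediate_value₂ (Set.left_mem_uIcc)
      (Set.right_mem_uIcc) (f : HomeoI).continuous.continuousOn
      (g : HomeoI).continuous.continuousOn ((hle _ _).1 h) hcon.le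
    have hne : (g : HomeoI)⁻¹ * f ≠ 1 := by
      intro h1
      rw [inv_mul_eq_one.1 h1] at hcon
      exact lt_irrefl _ hcon
    have hz' : ((g : HomeoI)⁻¹ * f) z = z := by
      rw [mul_apply, hfz, inv_apply_self]
    have hmz := (hfix _ (Γ.mul_mem (Γ.inv_mem g.2) f.2) hne z).1 hz'
    have hkz := hfix' k k.2 z hmz
    have hzx : z ≠ x₀ := by
      rintro rfl
      exact hx₀ hmz
    rcases Set.mem_uIcc.1 hz with h' | h'
    · have h2 := h'.2
      rw [← hkz, (k : HomeoI).le_iff_le] at h2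
      exact hzx (le_antisymm h2 h'.1)
    · have h2 := h'.1
      rw [← hkz, (k : HomeoI).le_iff_le] at h2
      exact hzx (le_antisymm h'.2 h2)⟩
  have harch : ∀ a b : Γ, 1 < a → ∃ n : ℕ, b < a ^ n := by
    intro a b ha
    have ha1 : (a : HomeoI) ≠ 1 := by
      intro h
      rw [hlt, h] at ha
      exact lt_irrefl _ ha
    obtain ⟨n, hn⟩ := exists_lt_pow_apply (f := a) (g := b)
      (fun x hx => hfix' b b.2 x ((hfix a a.2 ha1 x).1 hx)) ((hlt _ _).1 ha)
    exact ⟨n, hn⟩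
  intro a ha b hb
  exact congrArg Subtype.val (mul_comm_of_archimedean harch ⟨a, ha⟩ ⟨b, hb⟩)

/-- `f` extends to a real function with strict derivative `μ` at `a`. -/
def HasMult (f : HomeoI) (a : unitInterval) (μ : ℝ) : Prop :=
  ∃ F : ℝ → ℝ, HasStrictDerivAt F μ a ∧ ∀ x : unitInterval, F x = f x

lemma IsAnalytic.exists_hasMult {f : HomeoI} (hf : IsAnalytic f) (a : unitInterval) :
    ∃ μ, HasMult f a μ := by
  obtain ⟨F, hF, hFf⟩ := hf
  exact ⟨_, F, (hF a a.2).hasStrictDerivAt, hFf⟩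

lemma hasMult_one (a : unitInterval) : HasMult 1 a 1 :=
  ⟨id, hasStrictDerivAt_id _, fun _ => rfl⟩

lemma HasMult.mul {f g : HomeoI} {a : unitInterval} {μ ν : ℝ} (hf : HasMult f a μ)
    (hg : HasMult g a ν) (hga : g a = a) : HasMult (f * g) a (μ * ν) := by
  obtain ⟨F, hF, hFf⟩ := hf
  obtain ⟨G, hG, hGg⟩ := hg
  refine ⟨F ∘ G, HasStrictDerivAt.comp _ ?_ hG, fun x => ?_⟩
  · rwa [hGg, hga]
  · rw [Function.comp, hGg, hFf, mul_apply]

lemma HasMult.tendsto_slope {f : HomeoI} {a : unitInterval} {μ : ℝ} (hf : HasMult f a μ)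
    {ι : Type*} {l : Filter ι} {u v : ι → unitInterval} (hu : Tendsto u l (𝓝 a))
    (hv : Tendsto v l (𝓝 a)) (hne : ∀ᶠ i in l, u i ≠ v i) :
    Tendsto (fun i => ((f (u i) : ℝ) - f (v i)) / (u i - v i)) l (𝓝 μ) := by
  obtain ⟨F, hF, hFf⟩ := hf
  have hp : Tendsto (fun i => ((u i : ℝ), (v i : ℝ))) l (𝓝 ((a : ℝ), (a : ℝ))) :=
    (((continuous_subtype_val.tendsto a).comp hu).prodMk_nhds
      ((continuous_subtype_val.tendsto a).comp hv))
  have h1 := (hF.hasStrictFDerivAt.isLittleO.comp_tendsto hp).tendsto_div_nhds_zero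
  rw [← tendsto_sub_nhds_zero_iff]
  refine h1.congr' (hne.mono fun i hi => ?_)
  have hi' : (u i : ℝ) - v i ≠ 0 := sub_ne_zero.2 fun h => hi (Subtype.ext h)
  simp only [Function.comp, hFf]
  simp
  field_simp

lemma tendsto_val_nhdsNE (a : unitInterval) :
    Tendsto (fun x : unitInterval => x) (𝓝[≠] a) (𝓝 a) :=
  tendsto_id.mono_left nhdsWithin_le_nhds

lemma HasMult.tendsto_slope_self {f : HomeoI} {a : unitInterval} {μ : ℝ} (hf : HasMult f a μ) :
    Tendsto (fun x : unitInterval => ((f x : ℝ) - f a) / (x - a)) (𝓝[≠] a) (𝓝 μ) :=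
  hf.tendsto_slope (tendsto_val_nhdsNE a) tendsto_const_nhds self_mem_nhdsWithin

lemma HasMult.unique {f : HomeoI} {a : unitInterval} {μ ν : ℝ} (hf : HasMult f a μ)
    (hf' : HasMult f a ν) : μ = ν :=
  tendsto_nhds_unique hf.tendsto_slope_self hf'.tendsto_slope_self

lemma HasMult.mul_eq_one {f : HomeoI} {a : unitInterval} {μ ν : ℝ} (hf : HasMult f a μ)
    (hf' : HasMult f⁻¹ a ν) (ha : f a = a) : μ * ν = 1 := by
  have h := hf.mul hf' (inv_apply_eq_self.2 ha)
  rw [mul_inv_cancel] at h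
  exact h.unique (hasMult_one a)

lemma HasMult.nonneg {f : HomeoI} {a : unitInterval} {μ : ℝ} (hf : HasMult f a μ) : 0 ≤ μ := by
  refine ge_of_tendsto' hf.tendsto_slope_self fun x => ?_
  rcases le_total x a with h | h
  · exact div_nonneg_of_nonpos (sub_nonpos.2 (f.monotone h)) (sub_nonpos.2 h)
  · exact div_nonneg (sub_nonneg.2 (f.monotone h)) (sub_nonneg.2 h)

lemma HasMult.eventually_le {f : HomeoI} {a : unitInterval} {μ β : ℝ} (hf : HasMult f a μ)
    (hβ : μ < β) : ∃ δ > 0, ∀ x y : unitInterval, |(x : ℝ) - a| < δ → |(y : ℝ) - a| < δ →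
      |(f x : ℝ) - f y| ≤ β * |(x : ℝ) - y| := by
  have hμ := hf.nonneg
  obtain ⟨F, hF, hFf⟩ := hf
  have hb := hF.hasStrictFDerivAt.isLittleO.bound (sub_pos.2 hβ)
  obtain ⟨δ, hδ, hδF⟩ := Metric.eventually_nhds_iff.1 hb
  refine ⟨δ, hδ, fun x y hx hy => ?_⟩
  have h := hδF (y := ((x : ℝ), (y : ℝ))) (by
    rw [Prod.dist_eq, Real.dist_eq, Real.dist_eq]
    exact max_lt hx hy)
  simp only [hFf, Real.norm_eq_abs, ContinuousLinearMap.toSpanSingleton_apply, smul_eq_mul] at h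
  have h2 : |(f x : ℝ) - f y| ≤ |(f x : ℝ) - f y - (x - y) * μ| + |((x : ℝ) - y) * μ| := by
    simpa using abs_add_le ((f x : ℝ) - f y - (x - y) * μ) (((x : ℝ) - y) * μ)
  rw [abs_mul, abs_of_nonneg hμ] at h2
  linarith

lemma exists_factor {f : HomeoI} (hf : IsAnalytic f) (h1 : f ≠ 1) {a : unitInterval}
    (ha : f a = a) (hμ : HasMult f a 1) : ∃ (k : ℕ) (u : unitInterval → ℝ), 2 ≤ k ∧
      ContinuousAt u a ∧ u a ≠ 0 ∧ ∀ᶠ x in 𝓝 a, (f x : ℝ) - x = (x - a) ^ k * u x := by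
  have hne := eventually_apply_ne hf h1 a
  obtain ⟨F, hF, hFf⟩ := hf
  have hval : Tendsto (Subtype.val : unitInterval → ℝ) (𝓝 a) (𝓝 (a : ℝ)) :=
    continuous_subtype_val.tendsto a
  have hnz : ¬ ∀ᶠ x in 𝓝 (a : ℝ), F x - x = 0 := by
    intro h
    obtain ⟨x, hx, hx'⟩ := (hne.and ((hval.eventually h).filter_mono nhdsWithin_le_nhds)).exists
    rw [hFf, sub_eq_zero] at hx'
    exact hx (Subtype.ext hx')
  obtain ⟨k, u, hu, hua, hev⟩ := (AnalyticAt.exists_eventuallyEq_pow_smul_nonzero_iff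
    ((hF a a.2).sub analyticAt_id)).2 hnz
  have hev' : ∀ᶠ x : unitInterval in 𝓝 a, (f x : ℝ) - x = (x - a) ^ k * u x := by
    filter_upwards [hval.eventually hev] with x hx
    simpa [hFf] using hx
  have hcont : ContinuousAt (fun x : unitInterval => u x) a :=
    hu.continuousAt.comp (f := (Subtype.val : unitInterval → ℝ)) continuous_subtype_val.continuousAt
  refine ⟨k, fun x => u x, ?_, hcont, hua, hev'⟩
  by_contra! hk
  interval_cases k
  · have := hev'.self_of_nhds
    rw [ha] at this
    simp at this
    exact hua this.symm
  · have h2 : Tendsto (fun x : unitInterval => ((f x : ℝ) - f a) / (x - a) - 1) (𝓝[≠] a)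
        (𝓝 (1 - 1)) := hμ.tendsto_slope_self.sub_const 1
    have h3 : Tendsto (fun x : unitInterval => ((f x : ℝ) - f a) / (x - a) - 1) (𝓝[≠] a)
        (𝓝 (u a)) := by
      refine (hcont.tendsto.mono_left nhdsWithin_le_nhds).congr' ?_
      filter_upwards [hev'.filter_mono nhdsWithin_le_nhds, self_mem_nhdsWithin] with x hx hxa
      have hi : (x : ℝ) - a ≠ 0 := sub_ne_zero.2 fun h => hxa (Subtype.ext h)
      rw [ha]
      field_simp
      linarith
    exact hua (by simpa using tendsto_nhds_unique h3 h2)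

lemma exists_quadratic_bound {f : HomeoI} (hf : IsAnalytic f) (h1 : f ≠ 1) {a : unitInterval}
    (ha : f a = a) (hμ : HasMult f a 1) :
    ∃ C > 0, ∃ δ > 0, ∀ x : unitInterval, |(x : ℝ) - a| < δ →
      |(f x : ℝ) - x| ≤ C * |(x : ℝ) - a| ^ 2 := by
  obtain ⟨k, u, hk, hu, -, hev⟩ := exists_factor hf h1 ha hμ
  have hb := hu.abs.eventually_lt_const (lt_add_one |u a|)
  obtain ⟨δ, hδ, h⟩ := Metric.eventually_nhds_iff.1 (hb.and hev)
  refine ⟨|u a| + 1, by positivity, δ, hδ, fun x hx => ?_⟩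
  obtain ⟨h2, h3⟩ := h (y := x) hx
  rw [h3, abs_mul, abs_pow, mul_comm]
  have hle : |(x : ℝ) - a| ≤ 1 := by
    rw [abs_le]
    constructor <;> linarith [x.2.1, x.2.2, a.2.1, a.2.2]
  exact mul_le_mul h2.le (pow_le_pow_of_le_one (abs_nonneg _) hle hk) (by positivity)
    (by positivity)

/-- Conjugating by powers of an expansion contracts maps tangent to the identity. -/
lemma tendsto_conj_of_expanding {γ h : HomeoI} {a : unitInterval} {μ ν : ℝ}
    (hγ : HasMult γ a μ) (hγ' : HasMult γ⁻¹ a ν) (hμ : 1 < μ) (ha : γ a = a)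
    (hh : ∃ C > 0, ∃ δ > 0, ∀ x : unitInterval, |(x : ℝ) - a| < δ →
      |(h x : ℝ) - x| ≤ C * |(x : ℝ) - a| ^ 2) :
    ∃ t ∈ 𝓝 a, TendstoUniformlyOn (fun (n : ℕ) x => (γ ^ n * h * (γ ^ n)⁻¹) x) id atTop t := by
  obtain ⟨C, hC, δ₁, hδ₁, hquad⟩ := hh
  have hμν := hγ.mul_eq_one hγ' ha
  have hν0 := hγ'.nonneg
  have hν1 : ν < 1 := by nlinarith
  obtain ⟨κ, hνκ, hκ1, β, hμβ, hβκ⟩ : ∃ κ, ν < κ ∧ κ < 1 ∧ ∃ β, μ < β ∧ β * κ ^ 2 < 1 := by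
    have hκ : Tendsto (fun κ : ℝ => μ * κ ^ 2) (𝓝[>] ν) (𝓝 (μ * ν ^ 2)) :=
      ((by fun_prop : Continuous fun κ : ℝ => μ * κ ^ 2).tendsto ν).mono_left nhdsWithin_le_nhds
    have h1 : μ * ν ^ 2 < 1 := by
      rw [pow_two, ← mul_assoc, hμν, one_mul]
      exact hν1
    obtain ⟨κ, hκ1, hκ2, hκ3⟩ := ((hκ.eventually_lt_const h1).and
      (Ioo_mem_nhdsGT hν1)).exists
    have hβ : Tendsto (fun β : ℝ => β * κ ^ 2) (𝓝[>] μ) (𝓝 (μ * κ ^ 2)) :=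
      ((by fun_prop : Continuous fun β : ℝ => β * κ ^ 2).tendsto μ).mono_left nhdsWithin_le_nhds
    obtain ⟨β, hβ1, hβ2⟩ := ((hβ.eventually_lt_const hκ1).and self_mem_nhdsWithin).exists
    exact ⟨κ, hκ2, hκ3, β, hβ2, hβ1⟩
  have hβ0 : 0 < β := by linarith
  have hκ0 : 0 < κ := by linarith
  set θ := β * κ ^ 2 with hθ
  have hθ0 : 0 < θ := by positivity
  obtain ⟨δ₂, hδ₂, hexp⟩ := hγ.eventually_le hμβ
  obtain ⟨δ₃, hδ₃, hcon⟩ := hγ'.eventually_le hνκ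
  obtain ⟨δ, hδ, h1, h2, h3, h4⟩ : ∃ δ > 0, δ ≤ δ₁ ∧ δ ≤ δ₃ ∧ 2 * δ ≤ δ₂ ∧ C * δ ≤ 1 :=
    ⟨min (min δ₁ δ₃) (min (δ₂ / 2) (1 / C)), by positivity,
      (min_le_left _ _).trans (min_le_left _ _), (min_le_left _ _).trans (min_le_right _ _),
      by linarith [(min_le_right (min δ₁ δ₃) _).trans (min_le_left (δ₂ / 2) (1 / C))],
      by
        have := (min_le_right (min δ₁ δ₃) _).trans (min_le_right (δ₂ / 2) (1 / C))
        rwa [le_div_iff₀ hC, mul_comm] at this⟩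
  have key : ∀ (n : ℕ) (x : unitInterval), |(x : ℝ) - a| < δ →
      |((γ ^ n * h * (γ ^ n)⁻¹) x : ℝ) - x| ≤ C * θ ^ n * |(x : ℝ) - a| ^ 2 := by
    intro n
    induction n with
    | zero =>
      intro x hx
      simpa [one_apply, mul_apply] using hquad x (hx.trans_le h1)
    | succ n ih =>
      intro x hx
      have hsplit : (γ ^ (n + 1) * h * (γ ^ (n + 1))⁻¹) x
          = γ ((γ ^ n * h * (γ ^ n)⁻¹) (γ⁻¹ x)) := by
        rw [← mul_apply, ← mul_apply]
        congr 1
        rw [pow_succ']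
        group
      have hz : |((γ⁻¹ x : unitInterval) : ℝ) - a| ≤ κ * |(x : ℝ) - a| := by
        have := hcon x a (hx.trans_le h2) (by simpa using hδ₃)
        rwa [inv_apply_eq_self.2 ha] at this
      have habs := abs_nonneg ((x : ℝ) - a)
      have hzx : |((γ⁻¹ x : unitInterval) : ℝ) - a| < δ := by nlinarith
      have hi := ih _ hzx
      set z := γ⁻¹ x with hzdef
      set w := (γ ^ n * h * (γ ^ n)⁻¹) z with hw
      have hθn : θ ^ n ≤ 1 := pow_le_one₀ hθ0.le hβκ.le
      have hθn0 : 0 < θ ^ n := pow_pos hθ0 n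
      have hzabs := abs_nonneg ((z : ℝ) - a)
      have hwz : |(w : ℝ) - z| ≤ δ := by
        calc |(w : ℝ) - z| ≤ C * θ ^ n * |(z : ℝ) - a| ^ 2 := hi
          _ ≤ C * 1 * δ ^ 2 := by gcongr
          _ = C * δ * δ := by ring
          _ ≤ 1 * δ := by gcongr
          _ = δ := one_mul δ
      have hwa : |(w : ℝ) - a| < δ₂ := by
        have := abs_sub_le (w : ℝ) z a
        linarith
      have hg := hexp w z hwa (by linarith)
      rw [hzdef, apply_inv_self, ← hzdef] at hg
      rw [hsplit]
      calc |((γ w : unitInterval) : ℝ) - x| ≤ β * |(w : ℝ) - z| := hg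
        _ ≤ β * (C * θ ^ n * |(z : ℝ) - a| ^ 2) := by gcongr
        _ ≤ β * (C * θ ^ n * (κ * |(x : ℝ) - a|) ^ 2) := by gcongr
        _ = C * θ ^ (n + 1) * |(x : ℝ) - a| ^ 2 := by rw [hθ]; ring
  refine ⟨Metric.ball a δ, Metric.ball_mem_nhds a hδ, ?_⟩
  rw [Metric.tendstoUniformlyOn_iff]
  intro ε hε
  have hlim : Tendsto (fun n : ℕ => C * θ ^ n * δ ^ 2) atTop (𝓝 0) := by
    simpa using ((tendsto_pow_atTop_nhds_zero_of_lt_one hθ0.le hβκ).const_mul C).mul_const (δ ^ 2)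
  filter_upwards [hlim.eventually_lt_const hε] with n hn x hx
  rw [dist_comm]
  have hx' : |(x : ℝ) - a| < δ := hx
  calc |((γ ^ n * h * (γ ^ n)⁻¹) x : ℝ) - x| ≤ C * θ ^ n * |(x : ℝ) - a| ^ 2 := key n x hx'
    _ ≤ C * θ ^ n * δ ^ 2 := by gcongr
    _ < ε := hn

/-- A nontrivial map tangent to the identity does not commute with an expansion. -/
lemma eq_one_of_commute_expanding {γ h : HomeoI} (hγ' : IsAnalytic γ⁻¹)
    (hh : IsAnalytic h) {a : unitInterval} {μ : ℝ} (hμ : HasMult γ a μ) (hμ1 : 1 < μ)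
    (ha : γ a = a) (hha : h a = a) (hh1 : HasMult h a 1) (hc : γ * h = h * γ) : h = 1 := by
  by_contra hne
  obtain ⟨ν, hν⟩ := hγ'.exists_hasMult a
  obtain ⟨t, ht, hlim⟩ := tendsto_conj_of_expanding hμ hν hμ1 ha
    (exists_quadratic_bound hh hne hha hh1)
  refine hne (eq_one_of_frequently hh (a := a) (Eventually.frequently ?_))
  filter_upwards [mem_nhdsWithin_of_mem_nhds ht] with x hx
  have h1 := hlim.tendsto_at hx
  have h2 : ∀ n : ℕ, γ ^ n * h * (γ ^ n)⁻¹ = h := fun n => by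
    rw [((Commute.pow_left (show Commute γ h from hc) n).eq), mul_inv_cancel_right]
  simp only [h2] at h1
  exact tendsto_nhds_unique tendsto_const_nhds h1

lemma HasMult.isBigO {f : HomeoI} {a : unitInterval} {μ : ℝ} (hf : HasMult f a μ)
    {ι : Type*} {l : Filter ι} {u v : ι → unitInterval} (hu : Tendsto u l (𝓝 a))
    (hv : Tendsto v l (𝓝 a)) :
    (fun i => (f (u i) : ℝ) - f (v i)) =O[l] fun i => (u i : ℝ) - v i := by
  obtain ⟨δ, hδ, h⟩ := hf.eventually_le (lt_add_one μ)
  refine Asymptotics.IsBigO.of_bound (μ + 1) ?_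
  filter_upwards [hu (Metric.ball_mem_nhds a hδ), hv (Metric.ball_mem_nhds a hδ)] with i hi hi'
  exact h _ _ hi hi'

lemma tendsto_apply_nhdsNE (f : HomeoI) {a : unitInterval} (ha : f a = a) :
    Tendsto f (𝓝[≠] a) (𝓝[≠] a) := by
  refine tendsto_nhdsWithin_of_tendsto_nhds_of_eventually_within _ ?_ ?_
  · have := f.continuous.tendsto a
    rw [ha] at this
    exact this.mono_left nhdsWithin_le_nhds
  · filter_upwards [self_mem_nhdsWithin] with x hx
    exact fun h => hx (f.injective (Eq.trans h ha.symm))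

lemma tendsto_apply_nhds (f : HomeoI) {a : unitInterval} (ha : f a = a) :
    Tendsto f (𝓝[≠] a) (𝓝 a) :=
  (tendsto_apply_nhdsNE f ha).mono_right nhdsWithin_le_nhds

lemma pow_apply_eq_self {f : HomeoI} {a : unitInterval} (ha : f a = a) (n : ℕ) :
    (f ^ n) a = a := by
  induction n with
  | zero => rfl
  | succ n ih => rw [pow_succ, mul_apply, ha, ih]

lemma pow_displacement_isBigO {f : HomeoI} (hf : IsAnalytic f) {a : unitInterval} (ha : f a = a)
    (n : ℕ) : (fun x : unitInterval => ((f ^ n) x : ℝ) - x) =O[𝓝[≠] a]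
      fun x => (f x : ℝ) - x := by
  obtain ⟨μ, hμ⟩ := hf.exists_hasMult a
  induction n with
  | zero =>
    simp only [pow_zero, one_apply, sub_self]
    exact Asymptotics.isBigO_zero _ _
  | succ n ih =>
    have h1 := (hμ.isBigO (tendsto_apply_nhds _ (pow_apply_eq_self ha n))
      (tendsto_val_nhdsNE a)).trans ih
    refine (h1.add (Asymptotics.isBigO_refl _ _)).congr_left fun x => ?_
    rw [pow_succ', mul_apply]
    ring

lemma inv_displacement_isBigO {f : HomeoI} (hf : IsAnalytic f⁻¹) {a : unitInterval}
    (ha : f a = a) : (fun x : unitInterval => ((f⁻¹ x : unitInterval) : ℝ) - x) =O[𝓝[≠] a]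
      fun x => (f x : ℝ) - x := by
  obtain ⟨μ, hμ⟩ := hf.exists_hasMult a
  refine (hμ.isBigO (tendsto_val_nhdsNE a) (tendsto_apply_nhds f ha)).trans ?_ |>.congr_left
    fun x => by rw [inv_apply_self]
  exact (Asymptotics.isBigO_refl _ _).neg_left.congr_left fun x => by ring

lemma apply_lt_apply_of_ne {p q : HomeoI} {y y₀ : unitInterval} (h : p y₀ < q y₀)
    (hne : ∀ z ∈ Set.uIcc y y₀, p z ≠ q z) : p y < q y := by
  by_contra! hcon
  obtain ⟨z, hz, hz'⟩ := isPreconnected_uIcc.intermediate_value₂ (Set.right_mem_uIcc (a := y))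
    Set.left_mem_uIcc p.continuous.continuousOn q.continuous.continuousOn h.le hcon
  exact hne z hz hz'

lemma frequently_mem_uIcc {a y : unitInterval} (h : y ≠ a) :
    ∃ᶠ x in 𝓝[≠] a, x ∈ Set.uIcc a y := by
  rcases lt_or_gt_of_ne h with h | h
  · have : (𝓝[<] a).NeBot := nhdsLT_neBot_of_exists_lt ⟨y, h⟩
    have h1 : ∀ᶠ x in 𝓝[<] a, x ∈ Set.uIcc a y := by
      filter_upwards [Ioo_mem_nhdsLT h] with x hx
      exact Set.mem_uIcc.2 (Or.inr ⟨hx.1.le, hx.2.le⟩)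
    exact h1.frequently.filter_mono (nhdsWithin_mono _ fun x hx => ne_of_lt hx)
  · have : (𝓝[>] a).NeBot := nhdsGT_neBot_of_exists_gt ⟨y, h⟩
    have h1 : ∀ᶠ x in 𝓝[>] a, x ∈ Set.uIcc a y := by
      filter_upwards [Ioo_mem_nhdsGT h] with x hx
      exact Set.mem_uIcc.2 (Or.inl ⟨hx.1.le, hx.2.le⟩)
    exact h1.frequently.filter_mono (nhdsWithin_mono _ fun x hx => ne_of_gt hx)

lemma not_isLittleO_of_lt {Γ : Subgroup HomeoI} (hω : ∀ f ∈ Γ, IsAnalytic f) {f g : HomeoI}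
    (hf : f ∈ Γ) (hg : g ∈ Γ) (hc : f * g = g * f) {a y₀ : unitInterval} (hfa : f a = a)
    (hya : y₀ ≠ a) (hy : ∀ x ∈ Set.uIcc a y₀, x ≠ a → g x ≠ x)
    (hfy : y₀ < f y₀) (hgy : y₀ < g y₀) :
    ¬ (fun x : unitInterval => (f x : ℝ) - x) =o[𝓝[≠] a] fun x => (g x : ℝ) - x := by
  intro hlo
  have hf1 : f ≠ 1 := by
    rintro rfl
    exact lt_irrefl _ hfy
  obtain ⟨N, hN⟩ := exists_lt_pow_apply
    (fun x hx => apply_eq_self_of_commute (hω f hf) hf1 hc hx) hfy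
  have hlo' := (pow_displacement_isBigO (hω f hf) hfa N).trans_isLittleO hlo
  obtain ⟨y, ⟨hyI, hya'⟩, hle⟩ := (((frequently_mem_uIcc hya).and_eventually
    self_mem_nhdsWithin).and_eventually (hlo'.bound (half_pos one_pos))).exists
  have hsub : ∀ z ∈ Set.uIcc y y₀, z ∈ Set.uIcc a y₀ ∧ z ≠ a := by
    intro z hz
    refine ⟨Set.uIcc_subset_uIcc_right hyI hz, ?_⟩
    rintro rfl
    rcases Set.mem_uIcc.1 hz with h | h <;> rcases Set.mem_uIcc.1 hyI with h' | h'
    · exact hya' (le_antisymm h.1 h'.1)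
    · exact hya (le_antisymm (h'.1.trans h.1) h.2)
    · exact hya (le_antisymm h.1 (h'.1.trans h'.2))
    · exact hya' (le_antisymm h'.2 h.2)
  have h1 : y < g y := apply_lt_apply_of_ne (p := 1) hgy fun z hz =>
    (hy z (hsub z hz).1 (hsub z hz).2).symm
  have h2 : g y < (f ^ N) y := apply_lt_apply_of_ne hN fun z hz hgz => by
    have hk1 : g⁻¹ * f ^ N ≠ 1 := fun h => by
      rw [inv_mul_eq_one.1 h] at hN
      exact lt_irrefl _ hN
    have hkc : Commute (g⁻¹ * f ^ N) g :=
      (Commute.refl g).inv_left.mul_left ((show Commute f g from hc).pow_left N)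
    refine hy z (hsub z hz).1 (hsub z hz).2 (apply_eq_self_of_commute
      (hω _ (Γ.mul_mem (Γ.inv_mem hg) (Γ.pow_mem hf N))) hk1 hkc ?_)
    rw [mul_apply, ← hgz, inv_apply_self]
  have h1' : (y : ℝ) < g y := h1
  have h2' : ((g y : unitInterval) : ℝ) < (f ^ N) y := h2
  rw [Real.norm_of_nonneg (by linarith), Real.norm_of_nonneg (by linarith)] at hle
  linarith

/-- Displacements of commuting nontrivial analytic homeomorphisms are comparable at fixed
points. -/
lemma not_isLittleO_of_commute {Γ : Subgroup HomeoI} (hω : ∀ f ∈ Γ, IsAnalytic f)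
    {h m : HomeoI} (hh : h ∈ Γ) (hm : m ∈ Γ) (hh1 : h ≠ 1) (hm1 : m ≠ 1) (hc : h * m = m * h)
    {a : unitInterval} (ha : m a = a) :
    ¬ (fun x : unitInterval => (h x : ℝ) - x) =o[𝓝[≠] a] fun x => (m x : ℝ) - x := by
  intro hlo
  have hha : h a = a := apply_eq_self_of_commute (hω m hm) hm1 hc.symm ha
  obtain ⟨r, hr, hball⟩ := Metric.mem_nhdsWithin_iff.1 (eventually_apply_ne (hω m hm) hm1 a)
  have hr' : ∀ᶠ y in 𝓝[≠] a, y ∈ Metric.ball a r :=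
    nhdsWithin_le_nhds (Metric.ball_mem_nhds a hr)
  obtain ⟨y, hyr, hya⟩ := (hr'.and self_mem_nhdsWithin).exists
  have hy : ∀ x ∈ Set.uIcc a y, x ≠ a → m x ≠ x := by
    intro x hx hxa
    refine hball ⟨?_, hxa⟩
    have hyr' : |(y : ℝ) - a| < r := hyr
    have hx' : |(x : ℝ) - a| ≤ |(y : ℝ) - a| := by
      rcases Set.mem_uIcc.1 hx with h | h
      · have h1 : (a : ℝ) ≤ x := h.1
        have h2 : (x : ℝ) ≤ y := h.2
        rw [abs_of_nonneg (by linarith), abs_of_nonneg (by linarith)]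
        linarith
      · have h1 : (y : ℝ) ≤ x := h.1
        have h2 : (x : ℝ) ≤ a := h.2
        rw [abs_of_nonpos (by linarith), abs_of_nonpos (by linarith)]
        linarith
    exact hx'.trans_lt hyr'
  have hmy : m y ≠ y := hy y Set.right_mem_uIcc hya
  have hhy : h y ≠ y := fun e => hmy (apply_eq_self_of_commute (hω h hh) hh1 hc e)
  obtain ⟨f, hf, hfa, hfy, hfm, hfo⟩ : ∃ f ∈ Γ, f a = a ∧ y < f y ∧ f * m = m * f ∧
      (fun x : unitInterval => (f x : ℝ) - x) =o[𝓝[≠] a] fun x => (m x : ℝ) - x := by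
    rcases lt_or_gt_of_ne hhy with hlt | hlt
    · refine ⟨h⁻¹, Γ.inv_mem hh, inv_apply_eq_self.2 hha, ?_,
        (show Commute h m from hc).inv_left,
        (inv_displacement_isBigO (hω _ (Γ.inv_mem hh)) hha).trans_isLittleO hlo⟩
      rwa [← h.lt_iff_lt, apply_inv_self]
    · exact ⟨h, hh, hha, hlt, hc, hlo⟩
  rcases lt_or_gt_of_ne hmy with hlt | hlt
  · refine not_isLittleO_of_lt hω hf (Γ.inv_mem hm) (show Commute f m from hfm).inv_right hfa hya
      (fun x hx hxa => fun e => hy x hx hxa (inv_apply_eq_self.1 e)) hfy ?_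
      (hfo.trans_isBigO ?_)
    · rwa [← m.lt_iff_lt, apply_inv_self]
    · have := inv_displacement_isBigO (f := m⁻¹) (by rw [inv_inv]; exact hω m hm)
        (inv_apply_eq_self.2 ha)
      rwa [inv_inv] at this
  · exact not_isLittleO_of_lt hω hf hm hfm hfa hya hy hfy hlt hfo

/-- The displacement of a conjugate, compared with the original displacement at a fixed point. -/
lemma tendsto_conj_ratio {γ m : HomeoI} (hm : IsAnalytic m) (hm1 : m ≠ 1) {a : unitInterval}
    (ha : m a = a) (hma : HasMult m a 1) {μ : ℝ} (hγ : HasMult γ a μ) (hμ : 0 < μ)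
    (hγa : γ a = a) : ∃ k : ℕ, 1 ≤ k ∧ Tendsto (fun x : unitInterval =>
      (((γ * m * γ⁻¹) x : ℝ) - x) / ((m x : ℝ) - x)) (𝓝[≠] a) (𝓝 (μ⁻¹ ^ k)) := by
  obtain ⟨k, u, hk, hu, hua, hev⟩ := exists_factor hm hm1 ha hma
  refine ⟨k - 1, by omega, ?_⟩
  have hne := eventually_apply_ne hm hm1 a
  have hslope : Tendsto (fun y : unitInterval => ((γ (m y) : ℝ) - γ y) / (m y - y)) (𝓝[≠] a)
      (𝓝 μ) := hγ.tendsto_slope (tendsto_apply_nhds m ha) (tendsto_val_nhdsNE a) hne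
  have hγt := tendsto_apply_nhdsNE γ hγa
  have hu' : Tendsto u (𝓝[≠] a) (𝓝 (u a)) := hu.tendsto.mono_left nhdsWithin_le_nhds
  have hmain : Tendsto (fun y : unitInterval => ((γ (m y) : ℝ) - γ y) / ((m (γ y) : ℝ) - γ y))
      (𝓝[≠] a) (𝓝 (μ⁻¹ ^ (k - 1))) := by
    have h1 := (hslope.mul (((hγ.tendsto_slope_self.inv₀ hμ.ne').pow k).mul
      (hu'.div (hu'.comp hγt) hua)))
    have h2 : μ * (μ⁻¹ ^ k * (u a / u a)) = μ⁻¹ ^ (k - 1) := by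
      obtain ⟨j, rfl⟩ : ∃ j, k = j + 1 := ⟨k - 1, by omega⟩
      rw [div_self hua, Nat.add_sub_cancel, pow_succ]
      field_simp
    rw [h2] at h1
    refine h1.congr' ?_
    filter_upwards [hne, self_mem_nhdsWithin, hev.filter_mono nhdsWithin_le_nhds,
      hγt.eventually (hev.filter_mono nhdsWithin_le_nhds), hγt.eventually hne,
      hu'.eventually_ne hua, (hu'.comp hγt).eventually_ne hua, hγt.eventually self_mem_nhdsWithin]
      with y h3 h4 h5 h6 h7 h8 h9 h10
    have h4' : (y : ℝ) - a ≠ 0 := sub_ne_zero.2 fun h => h4 (Subtype.ext h)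
    have h10' : ((γ y : unitInterval) : ℝ) - a ≠ 0 := sub_ne_zero.2 fun h => h10 (Subtype.ext h)
    simp only [Function.comp, Pi.div_apply] at h9 ⊢
    rw [h5, h6, hγa, inv_div, div_pow]
    field_simp
  refine (hmain.comp (tendsto_apply_nhdsNE γ⁻¹ (inv_apply_eq_self.2 hγa))).congr fun x => ?_
  simp only [Function.comp, mul_apply, apply_inv_self]

lemma mult_ne_one_of_conj_ne {Γ : Subgroup HomeoI} (hω : ∀ f ∈ Γ, IsAnalytic f)
    {γ m : HomeoI} (hγ : γ ∈ Γ) (hm : m ∈ Γ) (hm1 : m ≠ 1)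
    (hne : γ * m * γ⁻¹ ≠ m) (hc : Commute (γ * m * γ⁻¹) m) {a : unitInterval} (ha : m a = a)
    (hma : HasMult m a 1) {μ : ℝ} (hγμ : HasMult γ a μ) (hγa : γ a = a) : μ ≠ 1 := by
  rintro rfl
  obtain ⟨k, -, hk⟩ := tendsto_conj_ratio (hω m hm) hm1 ha hma hγμ one_pos hγa
  rw [inv_one, one_pow] at hk
  set g := γ * m * γ⁻¹ with hg
  have hgΓ : g ∈ Γ := Γ.mul_mem (Γ.mul_mem hγ hm) (Γ.inv_mem hγ)
  have hga : g a = a := by rw [hg, mul_apply, mul_apply, inv_apply_eq_self.2 hγa, ha, hγa]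
  obtain ⟨ν, hν⟩ := (hω _ (Γ.inv_mem hm)).exists_hasMult a
  refine not_isLittleO_of_commute hω (h := m⁻¹ * g) (Γ.mul_mem (Γ.inv_mem hm) hgΓ) hm
    (fun h => hne (inv_mul_eq_one.1 h).symm) hm1
    ((Commute.refl m).inv_left.mul_left hc) ha ?_
  have hO := hν.isBigO (tendsto_apply_nhds g hga) (tendsto_apply_nhds m ha)
  simp only [inv_apply_self] at hO
  refine hO.trans_isLittleO ?_
  have hne0 : ∀ᶠ x : unitInterval in 𝓝[≠] a, (m x : ℝ) - x ≠ 0 := by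
    filter_upwards [eventually_apply_ne (hω m hm) hm1 a] with x hx
    exact sub_ne_zero.2 fun h => hx (Subtype.ext h)
  rw [Asymptotics.isLittleO_iff_tendsto' (hne0.mono fun x hx h => absurd h hx)]
  have := hk.sub_const 1
  rw [sub_self] at this
  refine this.congr' ?_
  filter_upwards [hne0] with x hx
  rw [div_sub_one hx]
  congr 1
  ring

/-- The situation of a nontrivial Abelian normal subgroup `M` of a group `Γ` of analytic
homeomorphisms. -/
structure IsAbelianNormal (Γ M : Subgroup HomeoI) : Prop where
  analytic : ∀ f ∈ Γ, IsAnalytic f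
  le : M ≤ Γ
  comm : ∀ a ∈ M, ∀ b ∈ M, a * b = b * a
  conj_mem : ∀ g ∈ Γ, ∀ m ∈ M, g * m * g⁻¹ ∈ M

lemma IsAbelianNormal.apply_eq_self {Γ M : Subgroup HomeoI} (H : IsAbelianNormal Γ M)
    {γ m : HomeoI} (hγ : γ ∈ Γ) (hm : m ∈ M) (hm1 : m ≠ 1) {x : unitInterval} (hx : m x = x) :
    γ x = x := by
  have hg := H.conj_mem γ hγ m hm
  have hg1 : γ * m * γ⁻¹ ≠ 1 := fun h => hm1 (conj_eq_one_iff.1 h)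
  refine apply_eq_self_of_preserves (H.analytic m (H.le hm)) hm1 (fun y => ?_) hx
  have h1 : (γ * m * γ⁻¹) (γ y) = γ y ↔ m y = y := by
    rw [mul_apply, mul_apply, inv_apply_self, γ.injective.eq_iff]
  rw [← h1]
  exact ⟨fun h => apply_eq_self_of_commute (H.analytic m (H.le hm)) hm1 (H.comm _ hm _ hg) h,
    fun h => apply_eq_self_of_commute (H.analytic _ (H.le hg)) hg1 (H.comm _ hg _ hm) h⟩

lemma IsAbelianNormal.exists_conj_ne {Γ M : Subgroup HomeoI} (H : IsAbelianNormal Γ M)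
    (hna : ¬ ∀ a ∈ Γ, ∀ b ∈ Γ, a * b = b * a) {m : HomeoI} (hm : m ∈ M) (hm1 : m ≠ 1) :
    ∃ γ ∈ Γ, γ * m * γ⁻¹ ≠ m := by
  by_contra! h
  refine hna (mul_comm_of_same_fixed hm1 fun f hf hf1 x => ?_)
  have hc : f * m = m * f := mul_inv_eq_iff_eq_mul.1 (h f hf)
  exact ⟨fun hx => apply_eq_self_of_commute (H.analytic f hf) hf1 hc hx,
    fun hx => apply_eq_self_of_commute (H.analytic m (H.le hm)) hm1 hc.symm hx⟩

/-- Noncentral elements of an Abelian normal subgroup are tangent to the identity at their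
fixed points. -/
lemma IsAbelianNormal.hasMult_one {Γ M : Subgroup HomeoI} (H : IsAbelianNormal Γ M)
    {γ m : HomeoI} (hγ : γ ∈ Γ) (hm : m ∈ M) (hm1 : m ≠ 1) (hne : γ * m * γ⁻¹ ≠ m)
    {a : unitInterval} (ha : m a = a) : HasMult m a 1 := by
  have hmΓ := H.le hm
  have hγa := H.apply_eq_self hγ hm hm1 ha
  have ha' := inv_apply_eq_self.2 ha
  obtain ⟨ν, hν⟩ := (H.analytic m hmΓ).exists_hasMult a
  obtain ⟨ν', hν'⟩ := (H.analytic _ (Γ.inv_mem hmΓ)).exists_hasMult a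
  obtain ⟨μ, hμ⟩ := (H.analytic γ hγ).exists_hasMult a
  obtain ⟨μ', hμ'⟩ := (H.analytic _ (Γ.inv_mem hγ)).exists_hasMult a
  have hνν := hν.mul_eq_one hν' ha
  have hμμ := hμ.mul_eq_one hμ' hγa
  have hh : HasMult (γ * m * γ⁻¹ * m⁻¹) a 1 := by
    have := ((hμ.mul hν ha).mul hμ' (inv_apply_eq_self.2 hγa)).mul hν' ha'
    rwa [show μ * ν * μ' * ν' = 1 by linear_combination μ * μ' * hνν + hμμ] at this
  have hhM : γ * m * γ⁻¹ * m⁻¹ ∈ M := M.mul_mem (H.conj_mem γ hγ m hm) (M.inv_mem hm)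
  have hh1 : γ * m * γ⁻¹ * m⁻¹ ≠ 1 := fun h => hne (mul_inv_eq_one.1 h)
  have hha : (γ * m * γ⁻¹ * m⁻¹) a = a :=
    apply_eq_self_of_commute (H.analytic m hmΓ) hm1 (H.comm _ hm _ hhM) ha
  rcases lt_trichotomy ν 1 with h | rfl | h
  · refine absurd (eq_one_of_commute_expanding ?_ (H.analytic _ (H.le hhM)) hν' ?_ ha' hha hh
      (H.comm _ (M.inv_mem hm) _ hhM)) hh1
    · rw [inv_inv]
      exact H.analytic m hmΓ
    · nlinarith [hν'.nonneg, hν.nonneg]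
  · exact hν
  · exact absurd (eq_one_of_commute_expanding (H.analytic _ (Γ.inv_mem hmΓ))
      (H.analytic _ (H.le hhM)) hν h ha hha hh (H.comm _ hm _ hhM)) hh1

lemma IsAbelianNormal.exists_expanding {Γ M : Subgroup HomeoI} (H : IsAbelianNormal Γ M)
    {γ m : HomeoI} (hγ : γ ∈ Γ) (hm : m ∈ M) (hm1 : m ≠ 1) (hne : γ * m * γ⁻¹ ≠ m) :
    ∃ δ ∈ Γ, ∀ a, m a = a → ∃ μ, 1 < μ ∧ HasMult δ a μ := by
  have hmΓ := H.le hm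
  have hg := H.conj_mem γ hγ m hm
  have hgm := H.comm _ hg _ hm
  have hpos : ∀ a, m a = a → ∀ μ, HasMult γ a μ →
      0 < μ ∧ HasMult γ⁻¹ a μ⁻¹ := by
    intro a ha μ hμ
    obtain ⟨μ', hμ'⟩ := (H.analytic _ (Γ.inv_mem hγ)).exists_hasMult a
    have h1 := hμ.mul_eq_one hμ' (H.apply_eq_self hγ hm hm1 ha)
    refine ⟨lt_of_le_of_ne hμ.nonneg ?_, ?_⟩
    · rintro rfl
      simp at h1
    · rwa [← eq_inv_of_mul_eq_one_right h1]
  set ρ : unitInterval → ℝ := fun x => (((γ * m * γ⁻¹) x : ℝ) - x) / ((m x : ℝ) - x) with hρ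
  have hfixed : ∀ a, m a = a → ∀ μ, HasMult γ a μ → ∃ k : ℕ, 1 ≤ k ∧ μ⁻¹ ^ k ≠ 1 ∧
      Tendsto ρ (𝓝[≠] a) (𝓝 (μ⁻¹ ^ k)) := by
    intro a ha μ hμ
    have hγa := H.apply_eq_self hγ hm hm1 ha
    have hma := H.hasMult_one hγ hm hm1 hne ha
    have h1 := mult_ne_one_of_conj_ne H.analytic hγ hmΓ hm1 hne hgm ha hma hμ hγa
    have h0 := (hpos a ha μ hμ).1
    obtain ⟨k, hk, hlim⟩ := tendsto_conj_ratio (H.analytic m hmΓ) hm1 ha hma hμ h0 hγa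
    refine ⟨k, hk, ?_, hlim⟩
    rw [Ne, pow_eq_one_iff_of_nonneg (inv_nonneg.2 h0.le) (by omega), inv_eq_one]
    exact h1
  have hlim : ∀ a, ∃ L, L ≠ 1 ∧ Tendsto ρ (𝓝[≠] a) (𝓝 L) := by
    intro a
    by_cases ha : m a = a
    · obtain ⟨μ, hμ⟩ := (H.analytic γ hγ).exists_hasMult a
      obtain ⟨k, -, h1, h2⟩ := hfixed a ha μ hμ
      exact ⟨_, h1, h2⟩
    · have ha' : (m a : ℝ) - a ≠ 0 := sub_ne_zero.2 fun h => ha (Subtype.ext h)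
      have hcont : ContinuousAt ρ a := by
        refine ContinuousAt.div ?_ ?_ ha'
        · exact ((continuous_subtype_val.comp (γ * m * γ⁻¹).continuous).sub
            continuous_subtype_val).continuousAt
        · exact ((continuous_subtype_val.comp m.continuous).sub
            continuous_subtype_val).continuousAt
      refine ⟨ρ a, fun h => ha ?_, hcont.tendsto.mono_left nhdsWithin_le_nhds⟩
      rw [hρ, div_eq_one_iff_eq ha', sub_left_inj] at h
      refine apply_eq_self_of_commute (f := m⁻¹ * (γ * m * γ⁻¹)) (H.analytic _
        (Γ.mul_mem (Γ.inv_mem hmΓ) (H.le hg))) (fun h => hne (inv_mul_eq_one.1 h).symm)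
        ((Commute.refl m).inv_left.mul_left hgm) ?_
      rw [mul_apply, show (γ * m * γ⁻¹) a = m a from Subtype.ext h, inv_apply_self]
  have hopen1 : IsOpen {a | ∀ᶠ x in 𝓝[≠] a, ρ x < 1} := isOpen_setOfPred_eventually_nhdsWithin
  have hopen2 : IsOpen {a | ∀ᶠ x in 𝓝[≠] a, 1 < ρ x} := isOpen_setOfPred_eventually_nhdsWithin
  have hcompl : {a | ∀ᶠ x in 𝓝[≠] a, ρ x < 1}ᶜ = {a | ∀ᶠ x in 𝓝[≠] a, 1 < ρ x} := by
    ext a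
    constructor
    · intro h
      obtain ⟨L, hL1, hL⟩ := hlim a
      rcases lt_or_gt_of_ne hL1 with h' | h'
      · exact absurd (hL.eventually_lt_const h') h
      · exact hL.eventually_const_lt h'
    · intro h h'
      have h1 : ∀ᶠ x in 𝓝[≠] a, 1 < ρ x := h
      have h2 : ∀ᶠ x in 𝓝[≠] a, ρ x < 1 := h'
      obtain ⟨x, hx, hx'⟩ := (h1.and h2).exists
      exact lt_asymm hx hx'
  have hclopen : IsClopen {a | ∀ᶠ x in 𝓝[≠] a, ρ x < 1} :=
    ⟨⟨hcompl ▸ hopen2⟩, hopen1⟩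
  rcases isClopen_iff.1 hclopen with h | h
  · refine ⟨γ⁻¹, Γ.inv_mem hγ, fun a ha => ?_⟩
    obtain ⟨μ, hμ⟩ := (H.analytic γ hγ).exists_hasMult a
    obtain ⟨k, hk, h1, h2⟩ := hfixed a ha μ hμ
    obtain ⟨h0, hinv⟩ := hpos a ha μ hμ
    refine ⟨μ⁻¹, ?_, hinv⟩
    rw [h, Set.compl_empty] at hcompl
    have hmem : a ∈ {a | ∀ᶠ x in 𝓝[≠] a, 1 < ρ x} := by
      rw [← hcompl]
      exact Set.mem_univ a
    have hev : ∀ᶠ x in 𝓝[≠] a, 1 < ρ x := hmem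
    have hle : 1 ≤ μ⁻¹ ^ k := ge_of_tendsto h2 (hev.mono fun x hx => hx.le)
    by_contra! hlt
    exact h1 (le_antisymm (pow_le_one₀ (inv_nonneg.2 h0.le) hlt) hle)
  · refine ⟨γ, hγ, fun a ha => ?_⟩
    obtain ⟨μ, hμ⟩ := (H.analytic γ hγ).exists_hasMult a
    obtain ⟨k, hk, h1, h2⟩ := hfixed a ha μ hμ
    obtain ⟨h0, -⟩ := hpos a ha μ hμ
    refine ⟨μ, ?_, hμ⟩
    have hmem : a ∈ {a | ∀ᶠ x in 𝓝[≠] a, ρ x < 1} := by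
      rw [h]
      exact Set.mem_univ a
    have hev : ∀ᶠ x in 𝓝[≠] a, ρ x < 1 := hmem
    have hle : μ⁻¹ ^ k ≤ 1 := le_of_tendsto h2 (hev.mono fun x hx => hx.le)
    by_contra! hlt
    exact h1 (le_antisymm hle (one_le_pow₀ ((one_le_inv₀ h0).2 hlt)))

lemma IsAbelianNormal.tendstoUniformly_conj {Γ M : Subgroup HomeoI} (H : IsAbelianNormal Γ M)
    {δ m : HomeoI} (hδ : δ ∈ Γ) (hm : m ∈ M) (hm1 : m ≠ 1)
    (hpar : ∀ a, m a = a → HasMult m a 1) (hexp : ∀ a, m a = a → ∃ μ, 1 < μ ∧ HasMult δ a μ) :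
    TendstoUniformly (fun (n : ℕ) x => (δ ^ n * m * (δ ^ n)⁻¹) x) id atTop := by
  have hfixed : ∀ a, m a = a → ∃ t ∈ 𝓝 a,
      TendstoUniformlyOn (fun (n : ℕ) x => (δ ^ n * m * (δ ^ n)⁻¹) x) id atTop t := by
    intro a ha
    obtain ⟨μ, hμ1, hμ⟩ := hexp a ha
    obtain ⟨ν, hν⟩ := (H.analytic _ (Γ.inv_mem hδ)).exists_hasMult a
    exact tendsto_conj_of_expanding hμ hν hμ1 (H.apply_eq_self hδ hm hm1 ha)
      (exists_quadratic_bound (H.analytic m (H.le hm)) hm1 ha (hpar a ha))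
  have hmoved : ∀ f ∈ M, (∀ a, f a = a → m a = a) → ∀ p, p < f p → ∃ t ∈ 𝓝 p,
      TendstoUniformlyOn (fun (n : ℕ) x => (δ ^ n * m * (δ ^ n)⁻¹) x) id atTop t := by
    intro f hf hfm p hp
    obtain ⟨s, hs, -, hlim⟩ := exists_fixed_limit hp
    obtain ⟨t, ht, hu⟩ := hfixed s (hfm s hs)
    obtain ⟨j, hj⟩ := (hlim.eventually (eventually_mem_nhds_iff.2 ht)).exists
    refine ⟨(f ^ j) ⁻¹' t, (f ^ j).continuous.continuousAt hj, ?_⟩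
    have huc : UniformContinuous (⇑((f ^ j)⁻¹ : HomeoI)) :=
      CompactSpace.uniformContinuous_of_continuous ((f ^ j)⁻¹).continuous
    have := huc.comp_tendstoUniformlyOn (hu.comp (f ^ j))
    convert this using 1
    · funext n x
      have hc := H.comm _ (H.conj_mem _ (Γ.pow_mem hδ n) m hm) _ (M.pow_mem hf j)
      simp only [Function.comp]
      rw [← mul_apply _ (f ^ j), hc, mul_apply (f ^ j), inv_apply_self]
    · funext x
      exact (inv_apply_self _ _).symm
  refine tendstoLocallyUniformly_iff_tendstoUniformly_of_compactSpace.1 ?_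
  rw [Metric.tendstoLocallyUniformly_iff]
  intro ε hε p
  obtain ⟨t, ht, hu⟩ : ∃ t ∈ 𝓝 p,
      TendstoUniformlyOn (fun (n : ℕ) x => (δ ^ n * m * (δ ^ n)⁻¹) x) id atTop t := by
    rcases lt_trichotomy (m p) p with h | h | h
    · refine hmoved m⁻¹ (M.inv_mem hm) (fun a => inv_apply_eq_self.1) p ?_
      rwa [← m.lt_iff_lt, apply_inv_self]
    · exact hfixed p h
    · exact hmoved m hm (fun a ha => ha) p h
  exact ⟨t, ht, Metric.tendstoUniformlyOn_iff.1 hu ε hε⟩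

lemma IsAbelianNormal.not_c0Discrete {Γ M : Subgroup HomeoI} (H : IsAbelianNormal Γ M)
    (hna : ¬ ∀ a ∈ Γ, ∀ b ∈ Γ, a * b = b * a) (hM : M ≠ ⊥) : ¬ C0Discrete M := by
  rintro ⟨ε, hε, hdisc⟩
  obtain ⟨m, hm, hm1⟩ := M.bot_or_exists_ne_one.resolve_left hM
  obtain ⟨γ, hγ, hne⟩ := H.exists_conj_ne hna hm hm1
  obtain ⟨δ, hδ, hexp⟩ := H.exists_expanding hγ hm hm1 hne
  have hu := H.tendstoUniformly_conj hδ hm hm1 (fun a ha => H.hasMult_one hγ hm hm1 hne ha) hexp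
  obtain ⟨n, hn⟩ := (Metric.tendstoUniformly_iff.1 hu ε hε).exists
  obtain ⟨x, hx⟩ := hdisc _ (H.conj_mem _ (Γ.pow_mem hδ n) m hm)
    fun h => hm1 (conj_eq_one_iff.1 h)
  have := hn x
  rw [dist_comm] at this
  exact absurd hx (not_le.2 this)

/-- A non-Abelian subgroup of `Diff^ω₊(I)` possessing a nontrivial Abelian normal
subgroup is not `C⁰`-discrete; moreover, every nontrivial Abelian normal subgroup of
it is not `C⁰`-discrete. -/
theorem not_C0Discrete_of_abelian_normal (Γ N : Subgroup HomeoI)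
    (hω : ∀ f ∈ Γ, IsAnalytic f)
    (hna : ¬ ∀ a ∈ Γ, ∀ b ∈ Γ, a * b = b * a)
    (hNle : N ≤ Γ) (hNnt : N ≠ ⊥)
    (hNab : ∀ a ∈ N, ∀ b ∈ N, a * b = b * a)
    (hNnorm : ∀ g ∈ Γ, ∀ n ∈ N, g * n * g⁻¹ ∈ N) :
    ¬ C0Discrete Γ ∧
    ∀ M : Subgroup HomeoI, M ≤ Γ → M ≠ ⊥ →
      (∀ a ∈ M, ∀ b ∈ M, a * b = b * a) →
      (∀ g ∈ Γ, ∀ m ∈ M, g * m * g⁻¹ ∈ M) →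
      ¬ C0Discrete M := by
  have key : ∀ M : Subgroup HomeoI, M ≤ Γ → M ≠ ⊥ → (∀ a ∈ M, ∀ b ∈ M, a * b = b * a) →
      (∀ g ∈ Γ, ∀ m ∈ M, g * m * g⁻¹ ∈ M) → ¬ C0Discrete M := fun M hle hnt hab hnorm =>
    IsAbelianNormal.not_c0Discrete ⟨hω, hle, hab, hnorm⟩ hna hnt
  refine ⟨?_, key⟩
  rintro ⟨ε, hε, h⟩
  exact key N hNle hNnt hNab hNnorm ⟨ε, hε, fun f hf => h f (hNle hf)⟩

end HeightHomeo
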